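/- arXiv:2409.06877 — 4 statements merged into one kernel-verified Lean document; each statement's English description precedes it below -/
import Mathlib

section
/- Consider a dynamically nontrivial (n,m,n) mass action network (full rank) which factors over a p-partition P. Assume the network has at most n+p distinct sources (rows of A take at most n+p distinct values) and that any two reactions with the same source belong to the same block of P. Then for each κ ∈ ℝ^m_+ exactly one of the following holds: (i) E_κ = ∅; (ii) E_κ consists of a single point, which is a nondegenerate equilibrium; (iii) E_κ is infinite and every x ∈ E_κ is degenerate. -/
open Matrix

noncomputable section

/-- Entrywise power of a vector by a real exponent matrix:
`(powVec M x) i = ∏ j, (x j) ^ (M i j)` (real powers). -/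
def powVec {k l : ℕ} (M : Matrix (Fin k) (Fin l) ℝ) (x : Fin l → ℝ) : Fin k → ℝ :=
  fun i => ∏ j, x j ^ M i j

/-- Cast an integer matrix to a real matrix. -/
def mR {a b : ℕ} (M : Matrix (Fin a) (Fin b) ℤ) : Matrix (Fin a) (Fin b) ℝ :=
  M.map fun t => (t : ℝ)

/-- The (open) positive orthant. -/
def posOrth (k : ℕ) : Set (Fin k → ℝ) :=
  {x | ∀ i, 0 < x i}

/-- The mass action vector field `g_κ(x) = Γ (κ ∘ x^A)`. -/
def massAction {n m : ℕ} (Γ : Matrix (Fin n) (Fin m) ℤ) (A : Matrix (Fin m) (Fin n) ℤ)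
    (κ : Fin m → ℝ) (x : Fin n → ℝ) : Fin n → ℝ :=
  (mR Γ).mulVec (κ * powVec (mR A) x)

/-- The positive equilibrium set `E_κ`. -/
def Eset {n m : ℕ} (Γ : Matrix (Fin n) (Fin m) ℤ) (A : Matrix (Fin m) (Fin n) ℤ)
    (κ : Fin m → ℝ) : Set (Fin n → ℝ) :=
  {x | (∀ i, 0 < x i) ∧ massAction Γ A κ x = 0}

/-- The Jacobian matrix `Γ D_{κ∘x^A} A D_{1/x}` of `g_κ` at `x`. -/
def jacMat {n m : ℕ} (Γ : Matrix (Fin n) (Fin m) ℤ) (A : Matrix (Fin m) (Fin n) ℤ)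
    (κ : Fin m → ℝ) (x : Fin n → ℝ) : Matrix (Fin n) (Fin n) ℝ :=
  mR Γ * Matrix.diagonal (κ * powVec (mR A) x) * mR A * Matrix.diagonal (fun i => (x i)⁻¹)

/-- Nondegeneracy of an equilibrium: `ker J_{g_κ}(x) ∩ im Γ = {0}`. -/
def nondegAt {n m : ℕ} (Γ : Matrix (Fin n) (Fin m) ℤ) (A : Matrix (Fin m) (Fin n) ℤ)
    (κ : Fin m → ℝ) (x : Fin n → ℝ) : Prop :=
  ∀ z : Fin n → ℝ, (jacMat Γ A κ x).mulVec z = 0 → (∃ v, (mR Γ).mulVec v = z) → z = 0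

/-- Strong degeneracy of the network: every positive equilibrium has Jacobian of
rank less than `rank Γ`, for every choice of rate constants. -/
def stronglyDegenerate {n m : ℕ} (Γ : Matrix (Fin n) (Fin m) ℤ)
    (A : Matrix (Fin m) (Fin n) ℤ) : Prop :=
  ∀ κ ∈ posOrth m, ∀ x ∈ Eset Γ A κ, (jacMat Γ A κ x).rank < (mR Γ).rank

/-- Dynamically nontrivial: the positive flux cone `ker Γ ∩ ℝ^m_+` is nonempty. -/
def dynNontrivial {n m : ℕ} (Γ : Matrix (Fin n) (Fin m) ℤ) : Prop :=
  ∃ v : Fin m → ℝ, (mR Γ).mulVec v = 0 ∧ ∀ j, 0 < v j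

/-- `ker Γ` factors over the partition of `{1,…,m}` given by the fibres of `blk`. -/
def factorsOver {n m p : ℕ} (Γ : Matrix (Fin n) (Fin m) ℤ) (blk : Fin m → Fin p) : Prop :=
  ∀ v : Fin m → ℝ, (mR Γ).mulVec v = 0 →
    ∀ i : Fin p, (mR Γ).mulVec (fun j => if blk j = i then v j else 0) = 0

/-- The matrix `[A | 1_P]`. -/
def srcMat {n m p : ℕ} (A : Matrix (Fin m) (Fin n) ℤ) (blk : Fin m → Fin p) :
    Matrix (Fin m) (Fin (n + p)) ℝ :=
  Matrix.of fun j => Fin.append (fun k => (A j k : ℝ)) (fun i => if blk j = i then 1 else 0)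

/-- The first `n` rows of an `(n+p)×k` matrix. -/
def topRows (n p : ℕ) {k : ℕ} (M : Matrix (Fin (n + p)) (Fin k) ℝ) :
    Matrix (Fin n) (Fin k) ℝ :=
  Matrix.of fun i j => M (Fin.castAdd p i) j

/-- The flux-cone parameterisation `(1_P λ) ∘ h(α)`. -/
def fluxParam {m p d : ℕ} (blk : Fin m → Fin p) (h : (Fin d → ℝ) → (Fin m → ℝ))
    (lam : Fin p → ℝ) (α : Fin d → ℝ) : Fin m → ℝ :=
  fun j => lam (blk j) * h α j

/-- Admissible cross-section parameterisation of the positive flux cone: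
`Y` is an open bounded convex set (an open polytope), `h` is affine and injective,
depends blockwise on the coordinates of `Y`, and `(λ, α) ↦ (1_P λ) ∘ h(α)` is a
bijection from `ℝ^p_+ × Y` onto the positive flux cone. -/
def admissibleH {n m p d : ℕ} (Γ : Matrix (Fin n) (Fin m) ℤ) (blk : Fin m → Fin p)
    (Y : Set (Fin d → ℝ)) (h : (Fin d → ℝ) → (Fin m → ℝ)) : Prop :=
  IsOpen Y ∧ Convex ℝ Y ∧ Bornology.IsBounded Y ∧ Y.Nonempty ∧
  (∃ (L : (Fin d → ℝ) →ₗ[ℝ] (Fin m → ℝ)) (c : Fin m → ℝ), ∀ α, h α = L α + c) ∧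
  (∃ bY : Fin d → Fin p, ∀ (α α' : Fin d → ℝ) (j : Fin m),
      (∀ t, bY t = blk j → α t = α' t) → h α j = h α' j) ∧
  (∀ (lam : Fin p → ℝ) (α : Fin d → ℝ), (∀ i, 0 < lam i) → α ∈ Y →
      (mR Γ).mulVec (fluxParam blk h lam α) = 0 ∧ ∀ j, 0 < fluxParam blk h lam α j) ∧
  (∀ v : Fin m → ℝ, (mR Γ).mulVec v = 0 → (∀ j, 0 < v j) →
      ∃ (lam : Fin p → ℝ) (α : Fin d → ℝ), (∀ i, 0 < lam i) ∧ α ∈ Y ∧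
        v = fluxParam blk h lam α) ∧
  (∀ (lam lam' : Fin p → ℝ) (α α' : Fin d → ℝ), (∀ i, 0 < lam i) → (∀ i, 0 < lam' i) →
      α ∈ Y → α' ∈ Y → fluxParam blk h lam α = fluxParam blk h lam' α' →
      lam = lam' ∧ α = α')

/-- The solvability variety `A_κ = {α ∈ Y : h(α)^W = κ^W}`. -/
def Aset {m d w : ℕ} (W : Matrix (Fin w) (Fin m) ℝ) (Y : Set (Fin d → ℝ))
    (h : (Fin d → ℝ) → (Fin m → ℝ)) (κ : Fin m → ℝ) : Set (Fin d → ℝ) :=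
  {α ∈ Y | powVec W (h α) = powVec W κ}

/-- The rows of `W` form a basis of `ker [A|1_P]ᵀ`. -/
def isSolvabilityMatrix {n m p w : ℕ} (A : Matrix (Fin m) (Fin n) ℤ) (blk : Fin m → Fin p)
    (W : Matrix (Fin w) (Fin m) ℝ) : Prop :=
  W * srcMat A blk = 0 ∧ W.rank = w ∧ w + (srcMat A blk).rank = m

/-- The columns of `Q` form a basis of `ker [A|1_P]`. -/
def isKernelMatrix {n m p q : ℕ} (A : Matrix (Fin m) (Fin n) ℤ) (blk : Fin m → Fin p)
    (Q : Matrix (Fin (n + p)) (Fin q) ℝ) : Prop :=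
  srcMat A blk * Q = 0 ∧ Q.rank = q ∧ (srcMat A blk).rank + q = n + p

/-- `G` is a generalised inverse of `[A|1_P]`. -/
def isGenInv {n m p : ℕ} (A : Matrix (Fin m) (Fin n) ℤ) (blk : Fin m → Fin p)
    (G : Matrix (Fin (n + p)) (Fin m) ℝ) : Prop :=
  srcMat A blk * G * srcMat A blk = srcMat A blk

/-- The parameterising map `F_κ(α,μ) = (h(α)/κ)^Ĝ ∘ μ^Q̂`. -/
def Fmap {n m p d q : ℕ} (G : Matrix (Fin (n + p)) (Fin m) ℝ)
    (Q : Matrix (Fin (n + p)) (Fin q) ℝ)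
    (h : (Fin d → ℝ) → (Fin m → ℝ)) (κ : Fin m → ℝ) :
    (Fin d → ℝ) × (Fin q → ℝ) → (Fin n → ℝ) :=
  fun z => powVec (topRows n p G) (h z.1 / κ) * powVec (topRows n p Q) z.2


lemma aux_pow {n m : ℕ} (A : Matrix (Fin m) (Fin n) ℤ) (x u : Fin n → ℝ) (hx : ∀ i, 0 < x i)
    (i : Fin m) :
    powVec (mR A) (fun j => x j * Real.exp (u j)) i
      = powVec (mR A) x i * Real.exp ((mR A).mulVec u i) := by
  simp only [powVec, Matrix.mulVec, dotProduct]
  rw [Real.exp_sum, ← Finset.prod_mul_distrib]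
  refine Finset.prod_congr rfl fun j _ => ?_
  rw [Real.mul_rpow (hx j).le (Real.exp_pos _).le, ← Real.exp_mul, mul_comm (u j)]

lemma aux_pos {n m : ℕ} (A : Matrix (Fin m) (Fin n) ℤ) (x : Fin n → ℝ) (hx : ∀ i, 0 < x i)
    (i : Fin m) : 0 < powVec (mR A) x i :=
  Finset.prod_pos fun j _ => Real.rpow_pos_of_pos (hx j) _

lemma aux_fac {n m p : ℕ} (Γ : Matrix (Fin n) (Fin m) ℤ) (blk : Fin m → Fin p)
    (hfac : factorsOver Γ blk) (v : Fin m → ℝ) (hv : (mR Γ).mulVec v = 0) (μ : Fin p → ℝ) :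
    (mR Γ).mulVec (fun j => v j * μ (blk j)) = 0 := by
  have h : (fun j => v j * μ (blk j))
      = ∑ i : Fin p, μ i • (fun j => if blk j = i then v j else 0) := by
    funext j
    simp [Finset.sum_apply, mul_comm]
  rw [h, Matrix.mulVec_sum]
  refine Finset.sum_eq_zero fun i _ => ?_
  rw [Matrix.mulVec_smul, hfac v hv i, smul_zero]

lemma aux_surj {n m : ℕ} (Γ : Matrix (Fin n) (Fin m) ℤ) (hrank : (mR Γ).rank = n)
    (z : Fin n → ℝ) : ∃ v, (mR Γ).mulVec v = z := by
  have h : LinearMap.range (mR Γ).mulVecLin = ⊤ := by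
    apply Submodule.eq_top_of_finrank_eq
    rw [Module.finrank_fin_fun]
    exact hrank
  have hz : z ∈ LinearMap.range (mR Γ).mulVecLin := by rw [h]; trivial
  obtain ⟨v, hv⟩ := hz
  exact ⟨v, hv⟩

lemma aux_jac {n m : ℕ} (Γ : Matrix (Fin n) (Fin m) ℤ) (A : Matrix (Fin m) (Fin n) ℤ)
    (κ : Fin m → ℝ) (x z : Fin n → ℝ) :
    (jacMat Γ A κ x).mulVec z
      = (mR Γ).mulVec (fun j => κ j * powVec (mR A) x j *
          (mR A).mulVec (fun i => (x i)⁻¹ * z i) j) := by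
  unfold jacMat
  rw [← Matrix.mulVec_mulVec, ← Matrix.mulVec_mulVec, ← Matrix.mulVec_mulVec]
  congr 1
  funext j
  rw [Matrix.mulVec_diagonal]
  congr 2
  funext i
  rw [Matrix.mulVec_diagonal]

lemma aux_nondeg {n m : ℕ} (Γ : Matrix (Fin n) (Fin m) ℤ) (A : Matrix (Fin m) (Fin n) ℤ)
    (hrank : (mR Γ).rank = n) (κ : Fin m → ℝ) (x : Fin n → ℝ) (hx : ∀ i, 0 < x i) :
    nondegAt Γ A κ x ↔ ∀ w : Fin n → ℝ,
      (mR Γ).mulVec (fun j => κ j * powVec (mR A) x j * (mR A).mulVec w j) = 0 → w = 0 := by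
  constructor
  · intro h w hw
    have h1 := h (fun i => x i * w i) (by
      rw [aux_jac, ← hw]
      have : (fun i => (x i)⁻¹ * (x i * w i)) = w := by
        funext i
        rw [inv_mul_cancel_left₀ (hx i).ne']
      rw [this]) (aux_surj Γ hrank _)
    funext i
    have h2 := congrFun h1 i
    simpa [(hx i).ne'] using h2
  · intro h z hz _
    rw [aux_jac] at hz
    have h1 := h _ hz
    funext i
    have h2 := congrFun h1 i
    simpa [(hx i).ne'] using h2

lemma aux_solve {n m p : ℕ} (A : Matrix (Fin m) (Fin n) ℤ)
    (blk : Fin m → Fin p) (hblk : Function.Surjective blk)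
    (hsrc : Set.ncard (Set.range fun i : Fin m => (fun j => A i j : Fin n → ℤ)) ≤ n + p)
    (hsame : ∀ i j : Fin m, (∀ k, A i k = A j k) → blk i = blk j)
    (hinj : ∀ (w : Fin n → ℝ) (μ : Fin p → ℝ), (∀ j, (mR A).mulVec w j = μ (blk j)) → w = 0)
    (c : Fin m → ℝ) (hc : ∀ i j : Fin m, (∀ k, A i k = A j k) → c i = c j) :
    ∃ (w : Fin n → ℝ) (μ : Fin p → ℝ), ∀ j, c j = (mR A).mulVec w j + μ (blk j) := by
  classical
  set src : Fin m → (Fin n → ℤ) := fun i => (fun j => A i j : Fin n → ℤ) with hsrcdef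
  let S := Set.range src
  let rep : S → Fin m := fun s => s.2.choose
  have hrep : ∀ s : S, src (rep s) = s.1 := fun s => s.2.choose_spec
  have hrep' : ∀ j : Fin m, ∀ k, A (rep ⟨src j, j, rfl⟩) k = A j k := fun j k =>
    congrFun (hrep ⟨src j, j, rfl⟩) k
  let T : ((Fin n → ℝ) × (Fin p → ℝ)) →ₗ[ℝ] (S → ℝ) :=
    { toFun := fun z s => (mR A).mulVec z.1 (rep s) + z.2 (blk (rep s))
      map_add' := by
        intro a b; funext s
        simp [Matrix.mulVec_add]; ring
      map_smul' := by
        intro a b; funext s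
        simp [Matrix.mulVec_smul]; ring }
  have hrow : ∀ (w : Fin n → ℝ) (j : Fin m),
      (mR A).mulVec w (rep ⟨src j, j, rfl⟩) = (mR A).mulVec w j := by
    intro w j
    simp only [Matrix.mulVec, dotProduct, mR, Matrix.map_apply]
    refine Finset.sum_congr rfl fun k _ => ?_
    rw [hrep' j k]
  have hT : ∀ z j, T z ⟨src j, j, rfl⟩ = (mR A).mulVec z.1 j + z.2 (blk j) := by
    intro z j
    change (mR A).mulVec z.1 (rep ⟨src j, j, rfl⟩) + z.2 (blk (rep ⟨src j, j, rfl⟩)) = _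
    rw [hrow, hsame _ _ (hrep' j)]
  have hTinj : Function.Injective T := by
    rw [injective_iff_map_eq_zero]
    rintro ⟨w, μ⟩ h0
    have h1 : ∀ j, (mR A).mulVec w j + μ (blk j) = 0 := fun j => by
      rw [← hT (w, μ) j, h0]; rfl
    have hw : w = 0 := hinj w (fun i => - μ i) fun j => by linarith [h1 j]
    subst hw
    have hμ : μ = 0 := by
      funext i
      obtain ⟨j, rfl⟩ := hblk i
      simpa using h1 j
    rw [hμ]; rfl
  have hcard : Fintype.card S ≤ n + p := by
    rw [← Nat.card_eq_fintype_card]; exact hsrc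
  have hfin : Module.finrank ℝ ((Fin n → ℝ) × (Fin p → ℝ)) = Module.finrank ℝ (S → ℝ) := by
    apply le_antisymm
    · exact LinearMap.finrank_le_finrank_of_injective hTinj
    · simpa using hcard
  have hsurj := (LinearMap.injective_iff_surjective_of_finrank_eq_finrank hfin).1 hTinj
  obtain ⟨z, hz⟩ := hsurj (fun s => c (rep s))
  refine ⟨z.1, z.2, fun j => ?_⟩
  rw [← hT, hz]
  exact hc _ _ fun k => (hrep' j k).symm

lemma aux_row {n m : ℕ} (A : Matrix (Fin m) (Fin n) ℤ) (w : Fin n → ℝ) (i j : Fin m)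
    (h : ∀ k, A i k = A j k) : (mR A).mulVec w i = (mR A).mulVec w j := by
  simp only [Matrix.mulVec, dotProduct, mR, Matrix.map_apply, h]

/-- Nondegenerate equilibria are unique. -/
lemma aux_unique {n m p : ℕ}
    (Γ : Matrix (Fin n) (Fin m) ℤ) (A : Matrix (Fin m) (Fin n) ℤ)
    (hrank : (mR Γ).rank = n)
    (blk : Fin m → Fin p) (hblk : Function.Surjective blk) (hfac : factorsOver Γ blk)
    (hsrc : Set.ncard (Set.range fun i : Fin m => (fun j => A i j : Fin n → ℤ)) ≤ n + p)
    (hsame : ∀ i j : Fin m, (∀ k, A i k = A j k) → blk i = blk j)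
    (κ : Fin m → ℝ) (x : Fin n → ℝ) (hx : x ∈ Eset Γ A κ)
    (hnd : nondegAt Γ A κ x) (x' : Fin n → ℝ) (hx' : x' ∈ Eset Γ A κ) : x' = x := by
  rw [aux_nondeg Γ A hrank κ x hx.1] at hnd
  have hE : (mR Γ).mulVec (fun j => κ j * powVec (mR A) x j) = 0 := hx.2
  have hinj : ∀ (w : Fin n → ℝ) (μ : Fin p → ℝ),
      (∀ j, (mR A).mulVec w j = μ (blk j)) → w = 0 := by
    intro w μ h
    apply hnd
    simp only [h]
    exact aux_fac Γ blk hfac _ hE μ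
  set u : Fin n → ℝ := fun j => Real.log (x' j / x j) with hu
  have hxu : x' = fun j => x j * Real.exp (u j) := by
    funext j
    rw [hu]
    simp only
    rw [Real.exp_log (div_pos (hx'.1 j) (hx.1 j)), mul_div_cancel₀ _ (hx.1 j).ne']
  obtain ⟨w, μ, hw⟩ := aux_solve A blk hblk hsrc hsame hinj
    (fun j => Real.exp ((mR A).mulVec u j)) (fun i j h => by simp only [aux_row A u i j h])
  have hE' : (mR Γ).mulVec
      (fun j => κ j * powVec (mR A) x j * Real.exp ((mR A).mulVec u j)) = 0 := by
    rw [← hx'.2]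
    unfold massAction
    congr 1
    funext j
    rw [Pi.mul_apply, hxu, aux_pow A x u hx.1, mul_assoc]
  have hw0 : w = 0 := by
    apply hnd
    have h1 : (fun j => κ j * powVec (mR A) x j * (mR A).mulVec w j)
      = (fun j => κ j * powVec (mR A) x j * Real.exp ((mR A).mulVec u j))
        - (fun j => κ j * powVec (mR A) x j * μ (blk j)) := by
      funext j
      simp only [Pi.sub_apply, hw j]
      ring
    rw [h1, Matrix.mulVec_sub, hE', aux_fac Γ blk hfac _ hE μ, sub_zero]
  have hu0 : u = 0 := by
    refine hinj u (fun i => Real.log (μ i)) fun j => ?_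
    have := hw j
    simp only [hw0, Matrix.mulVec_zero, Pi.zero_apply, zero_add] at this
    rw [← this, Real.log_exp]
  rw [hxu, hu0]
  funext j
  simp

/-- A degenerate equilibrium forces infinitely many equilibria. -/
lemma aux_infinite {n m p : ℕ}
    (Γ : Matrix (Fin n) (Fin m) ℤ) (A : Matrix (Fin m) (Fin n) ℤ)
    (hrank : (mR Γ).rank = n)
    (blk : Fin m → Fin p) (hblk : Function.Surjective blk) (hfac : factorsOver Γ blk)
    (hsrc : Set.ncard (Set.range fun i : Fin m => (fun j => A i j : Fin n → ℤ)) ≤ n + p)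
    (hsame : ∀ i j : Fin m, (∀ k, A i k = A j k) → blk i = blk j)
    (κ : Fin m → ℝ) (x : Fin n → ℝ) (hx : x ∈ Eset Γ A κ)
    (hnd : ¬ nondegAt Γ A κ x) : (Eset Γ A κ).Infinite := by
  rw [aux_nondeg Γ A hrank κ x hx.1] at hnd
  have hE : (mR Γ).mulVec (fun j => κ j * powVec (mR A) x j) = 0 := hx.2
  have hmem : ∀ u : Fin n → ℝ, (mR Γ).mulVec
      (fun j => κ j * powVec (mR A) x j * Real.exp ((mR A).mulVec u j)) = 0 →
      (fun j => x j * Real.exp (u j)) ∈ Eset Γ A κ := by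
    intro u h
    refine ⟨fun i => mul_pos (hx.1 i) (Real.exp_pos _), ?_⟩
    rw [← h]
    unfold massAction
    congr 1
    funext j
    rw [Pi.mul_apply, aux_pow A x u hx.1, mul_assoc]
  have hcancel : ∀ u u' : Fin n → ℝ, (fun j => x j * Real.exp (u j)) =
      (fun j => x j * Real.exp (u' j)) → u = u' := by
    intro u u' h
    funext j
    have := congrFun h j
    simpa [(hx.1 j).ne'] using this
  by_cases hinj : ∀ (w : Fin n → ℝ) (μ : Fin p → ℝ),
      (∀ j, (mR A).mulVec w j = μ (blk j)) → w = 0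
  · push Not at hnd
    obtain ⟨w, hw, hw0⟩ := hnd
    set c := (mR A).mulVec w with hc
    set B : ℝ := 1 + ∑ j, |c j| with hB
    have hcB : ∀ j, |c j| < B := fun j => by
      have := Finset.single_le_sum (f := fun j => |c j|) (fun i _ => abs_nonneg _)
        (Finset.mem_univ j)
      linarith
    have hBpos : 0 < B := by
      have : 0 ≤ ∑ j, |c j| := Finset.sum_nonneg fun i _ => abs_nonneg _
      linarith
    have hpos : ∀ t ∈ Set.Ioo (0:ℝ) B⁻¹, ∀ j, 0 < 1 + t * c j := by
      intro t ht j
      have h1 : t * B < 1 := by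
        have := mul_lt_mul_of_pos_right ht.2 hBpos
        rwa [inv_mul_cancel₀ hBpos.ne'] at this
      have h2 : t * |c j| ≤ t * B := mul_le_mul_of_nonneg_left (hcB j).le ht.1.le
      have h3 : t * (-|c j|) ≤ t * c j := mul_le_mul_of_nonneg_left (neg_abs_le _) ht.1.le
      linarith
    have hsol : ∀ t : ℝ, ∃ (u : Fin n → ℝ) (μ : Fin p → ℝ), ∀ j,
        Real.log (1 + t * c j) = (mR A).mulVec u j + μ (blk j) := fun t =>
      aux_solve A blk hblk hsrc hsame hinj (fun j => Real.log (1 + t * c j))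
        (fun i j h => by simp only [hc, aux_row A w i j h])
    choose u μ huμ using hsol
    refine Set.infinite_of_injOn_mapsTo (s := Set.Ioo (0:ℝ) B⁻¹)
      (f := fun t => (fun j => x j * Real.exp (u t j))) ?_ ?_ (Set.Ioo_infinite (inv_pos.2 hBpos))
    · intro t ht t' ht' h
      by_contra hne
      have huu := hcancel _ _ h
      apply hw0
      -- the ratio depends only on the block
      have hr : ∀ j, 1 + t * c j = (1 + t' * c j) * Real.exp (μ t (blk j) - μ t' (blk j)) := by
        intro j
        have h1 := huμ t j
        have h2 := huμ t' j
        rw [huu] at h1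
        rw [← Real.exp_log (hpos t ht j), ← Real.exp_log (hpos t' ht' j), ← Real.exp_add, h1, h2]
        congr 1
        ring
      refine hinj w (fun i => (Real.exp (μ t i - μ t' i) - 1) /
        (t - t' * Real.exp (μ t i - μ t' i))) fun j => ?_
      have h1 := hr j
      set e := Real.exp (μ t (blk j) - μ t' (blk j)) with he
      have hne' : t - t' * e ≠ 0 := by
        intro h0
        have he1 : e = 1 := by linear_combination c j * h0 - h1
        apply hne
        rw [he1] at h0
        linarith
      change c j = (e - 1) / (t - t' * e)
      rw [eq_div_iff hne']
      linear_combination h1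
    · intro t ht
      apply hmem
      have h0 : (mR Γ).mulVec (fun j => κ j * powVec (mR A) x j * (1 + t * c j)) = 0 := by
        have h1 : (fun j => κ j * powVec (mR A) x j * (1 + t * c j))
            = (fun j => κ j * powVec (mR A) x j)
              + t • (fun j => κ j * powVec (mR A) x j * c j) := by
          funext j
          simp only [Pi.add_apply, Pi.smul_apply, smul_eq_mul]
          ring
        rw [h1, Matrix.mulVec_add, Matrix.mulVec_smul, hE, hw, smul_zero, add_zero]
      have h2 := aux_fac Γ blk hfac _ h0 (fun i => Real.exp (- μ t i))
      rw [← h2]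
      congr 1
      funext j
      have h3 : (mR A).mulVec (u t) j = Real.log (1 + t * c j) + - μ t (blk j) := by
        rw [huμ t j]; ring
      rw [h3, Real.exp_add, Real.exp_log (hpos t ht j), mul_assoc, mul_assoc, mul_assoc]
  · push Not at hinj
    obtain ⟨w, μ, hw, hw0⟩ := hinj
    refine Set.infinite_of_injective_forall_mem
      (f := fun t : ℝ => (fun j => x j * Real.exp ((t • w) j))) ?_ ?_
    · intro t t' h
      exact smul_left_injective ℝ hw0 (hcancel _ _ h)
    · intro t
      apply hmem
      have := aux_fac Γ blk hfac _ hE (fun i => Real.exp (t * μ i))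
      rw [← this]
      congr 1
      funext j
      rw [Matrix.mulVec_smul, Pi.smul_apply, hw j, smul_eq_mul]

/-- Theorem `thmfewsources`: a dynamically nontrivial full-rank
network factoring over a `p`-partition, with at most `n+p` distinct sources and
reactions sharing a source lying in the same block, has for each `κ` either no
positive equilibrium, a unique nondegenerate positive equilibrium, or infinitely
many positive equilibria all of which are degenerate. -/
theorem statement14 {n m p : ℕ}
    (Γ : Matrix (Fin n) (Fin m) ℤ) (A : Matrix (Fin m) (Fin n) ℤ)
    (hA : ∀ i j, 0 ≤ A i j)
    (hdyn : dynNontrivial Γ) (hrank : (mR Γ).rank = n)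
    (blk : Fin m → Fin p) (hblk : Function.Surjective blk) (hfac : factorsOver Γ blk)
    (hsrc : Set.ncard (Set.range fun i : Fin m => (fun j => A i j : Fin n → ℤ)) ≤ n + p)
    (hsame : ∀ i j : Fin m, (∀ k, A i k = A j k) → blk i = blk j)
    (κ : Fin m → ℝ) (hκ : κ ∈ posOrth m) :
    Eset Γ A κ = ∅ ∨
    (∃ x : Fin n → ℝ, Eset Γ A κ = {x} ∧ nondegAt Γ A κ x) ∨
    ((Eset Γ A κ).Infinite ∧ ∀ x ∈ Eset Γ A κ, ¬ nondegAt Γ A κ x) := by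
  by_cases hne : Eset Γ A κ = ∅
  · exact Or.inl hne
  · right
    obtain ⟨x, hx⟩ := Set.nonempty_iff_ne_empty.2 hne
    by_cases hex : ∃ y ∈ Eset Γ A κ, nondegAt Γ A κ y
    · left
      obtain ⟨y, hy, hyn⟩ := hex
      refine ⟨y, ?_, hyn⟩
      ext z
      constructor
      · exact fun hz => aux_unique Γ A hrank blk hblk hfac hsrc hsame κ y hy hyn z hz
      · intro hz
        rw [Set.mem_singleton_iff.1 hz]
        exact hy
    · right
      have hall : ∀ y ∈ Eset Γ A κ, ¬ nondegAt Γ A κ y := fun y hy h => hex ⟨y, hy, h⟩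
      exact ⟨aux_infinite Γ A hrank blk hblk hfac hsrc hsame κ x hx (hall x hx), hall⟩

end
end

section
/- Let n ≥ 1 and let A ∈ ℤ_{≥0}^{(n+2)×n} be a matrix each of whose rows sums to at most 2 (a quadratic exponent matrix with n+2 rows). Then there exists a row vector w ∈ ℤ^{n+2} with w ≠ 0, Σ_{i=1}^{n+2} w_i = 0, wA = 0, and deg w ≤ n+1. -/
/-- Existence of a small kernel vector for matrices with `m + 1` rows and `m` columns. -/
def SmallKer (m : ℕ) : Prop :=
  ∀ A : Fin (m + 1) → Fin m → ℤ, (∀ i, ∑ j, |A i j| ≤ 2) → (∀ i, Even (∑ j, A i j)) →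
    ∃ w : Fin (m + 1) → ℤ, w ≠ 0 ∧ (∀ j, ∑ i, w i * A i j = 0) ∧
      (∑ i, |w i| ≤ 2 * (m : ℤ)) ∧ ∀ i, |w i| ≤ 2

theorem smallKer_one : SmallKer 1 := by
  intro A h1 h2
  have a0 := h1 0
  have a1 := h1 1
  have b0 := h2 0
  have b1 := h2 1
  simp only [Fin.sum_univ_one] at a0 a1 b0 b1
  rw [abs_le] at a0 a1
  obtain ⟨x, hx⟩ := b0
  obtain ⟨y, hy⟩ := b1
  have key : ∃ p q : ℤ, (p ≠ 0 ∨ q ≠ 0) ∧ p * x + q * y = 0 ∧ |p| + |q| ≤ 2 ∧ |p| ≤ 2 ∧ |q| ≤ 2 := by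
    have hx1 : -1 ≤ x := by omega
    have hx2 : x ≤ 1 := by omega
    have hy1 : -1 ≤ y := by omega
    have hy2 : y ≤ 1 := by omega
    by_cases hx0 : x = 0
    · exact ⟨1, 0, by simp, by simp [hx0], by simp, by simp, by simp⟩
    by_cases hy0 : y = 0
    · exact ⟨0, 1, by simp, by simp [hy0], by simp, by simp, by simp⟩
    by_cases hxy : x = y
    · exact ⟨1, -1, by simp, by simp [hxy], by simp, by simp, by simp⟩
    · exact ⟨1, 1, by simp, by omega, by simp, by simp, by simp⟩
  obtain ⟨p, q, hpq, he, hn, hp, hq⟩ := key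
  refine ⟨![p, q], ?_, ?_, ?_, ?_⟩
  · intro h
    have e0 := congrFun h 0
    have e1 := congrFun h 1
    simp at e0 e1
    omega
  · intro j
    fin_cases j
    simp [Fin.sum_univ_two]
    rw [hx, hy]
    linarith
  · simpa [Fin.sum_univ_two] using hn
  · intro i
    fin_cases i
    · simpa using hp
    · simpa using hq

/-- The possible rows with two columns. -/
def rows2 : List (ℤ × ℤ) :=
  [(0, 0), (2, 0), (-2, 0), (0, 2), (0, -2), (1, 1), (1, -1), (-1, 1), (-1, -1)]

/-- Candidate kernel vectors for the two-column case. -/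
def cands : List (ℤ × ℤ × ℤ) :=
  [(1,0,0), (0,1,0), (0,0,1), (1,1,0), (1,-1,0), (1,0,1), (1,0,-1), (0,1,1), (0,1,-1),
   (1,1,2), (1,1,-2), (1,-1,2), (1,-1,-2), (1,2,1), (1,2,-1), (1,-2,1), (1,-2,-1),
   (2,1,1), (2,1,-1), (2,-1,1), (2,-1,-1), (1,1,1), (1,1,-1), (1,-1,1), (1,-1,-1)]

theorem rows2_cands : ∀ a ∈ rows2, ∀ b ∈ rows2, ∀ c ∈ rows2, ∃ p ∈ cands,
    p.1 * a.1 + p.2.1 * b.1 + p.2.2 * c.1 = 0 ∧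
    p.1 * a.2 + p.2.1 * b.2 + p.2.2 * c.2 = 0 := by
  decide +kernel

theorem cands_prop : ∀ p ∈ cands, (p.1 ≠ 0 ∨ p.2.1 ≠ 0 ∨ p.2.2 ≠ 0) ∧
    |p.1| + |p.2.1| + |p.2.2| ≤ 4 ∧ |p.1| ≤ 2 ∧ |p.2.1| ≤ 2 ∧ |p.2.2| ≤ 2 := by
  decide +kernel

theorem mem_rows2 (a b : ℤ) (h : |a| + |b| ≤ 2) (he : Even (a + b)) : (a, b) ∈ rows2 := by
  have ha : |a| ≤ 2 := by linarith [abs_nonneg b]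
  have hb : |b| ≤ 2 := by linarith [abs_nonneg a]
  rw [abs_le] at ha hb
  obtain ⟨a1, a2⟩ := ha
  obtain ⟨b1, b2⟩ := hb
  interval_cases a <;> interval_cases b <;> revert h he <;> decide

theorem smallKer_two : SmallKer 2 := by
  intro A h1 h2
  simp only [Fin.sum_univ_two] at h1 h2
  have hm := fun i => mem_rows2 _ _ (h1 i) (h2 i)
  obtain ⟨p, hp, e0, e1⟩ := rows2_cands _ (hm 0) _ (hm 1) _ (hm 2)
  obtain ⟨hn, hs, k0, k1, k2⟩ := cands_prop p hp
  refine ⟨![p.1, p.2.1, p.2.2], ?_, ?_, ?_, ?_⟩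
  · intro h
    have e0 := congrFun h 0
    have e1 := congrFun h 1
    have e2 := congrFun h 2
    simp at e0 e1 e2
    omega
  · intro j
    fin_cases j
    · simpa [Fin.sum_univ_three] using e0
    · simpa [Fin.sum_univ_three] using e1
  · simpa [Fin.sum_univ_three] using hs
  · intro i
    fin_cases i
    · simpa using k0
    · simpa using k1
    · simpa using k2

theorem smallKer_step (k : ℕ) (hk : 2 ≤ k) (ih : SmallKer k) : SmallKer (k + 1) := by
  intro A h1 h2
  obtain ⟨v, hv⟩ : ∃ v, ∑ i, |A i v| ≤ 2 := by
    by_contra! hc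
    have l1 : ∑ j : Fin (k + 1), (3 : ℤ) ≤ ∑ j, ∑ i, |A i j| :=
      Finset.sum_le_sum fun j _ => hc j
    rw [Finset.sum_comm] at l1
    have l2 : ∑ i, ∑ j, |A i j| ≤ ∑ i : Fin (k + 1 + 1), (2 : ℤ) :=
      Finset.sum_le_sum fun i _ => h1 i
    simp at l1 l2
    omega
  have r1 : ∀ i, |A i v| + ∑ j, |A i (v.succAbove j)| ≤ 2 := fun i => by
    rw [← Fin.sum_univ_succAbove (fun j => |A i j|) v]; exact h1 i
  have r2 : ∀ i, Even (A i v + ∑ j, A i (v.succAbove j)) := fun i => by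
    rw [← Fin.sum_univ_succAbove (fun j => A i j) v]; exact h2 i
  by_cases hcase : ∃ e, ∀ i, i ≠ e → A i v = 0
  · obtain ⟨e, he⟩ := hcase
    have he' : ∀ i, A (e.succAbove i) v = 0 := fun i => he _ (Fin.succAbove_ne e i)
    obtain ⟨w, w0, wk, ws, wb⟩ := ih (fun i j => A (e.succAbove i) (v.succAbove j))
      (fun i => by have := r1 (e.succAbove i); rw [he' i] at this; simpa using this)
      (fun i => by have := r2 (e.succAbove i); rw [he' i] at this; simpa using this)
    refine ⟨e.insertNth 0 w, ?_, ?_, ?_, ?_⟩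
    · intro h
      apply w0
      funext i
      have := congrFun h (e.succAbove i)
      simpa using this
    · intro j
      rw [Fin.sum_univ_succAbove _ e]
      simp only [Fin.insertNth_apply_same, Fin.insertNth_apply_succAbove, zero_mul, zero_add]
      rcases Fin.eq_self_or_eq_succAbove v j with rfl | ⟨j', rfl⟩
      · simp [he']
      · exact wk j'
    · rw [Fin.sum_univ_succAbove _ e]
      simp only [Fin.insertNth_apply_same, Fin.insertNth_apply_succAbove]
      push_cast
      simp
      linarith
    · intro i
      rcases Fin.eq_self_or_eq_succAbove e i with rfl | ⟨i', rfl⟩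
      · simp
      · simpa using wb i'
  · push Not at hcase
    obtain ⟨e, -, he⟩ := hcase 0
    obtain ⟨f, hfe, hf⟩ := hcase e
    obtain ⟨f0, rfl⟩ := Fin.exists_succAbove_eq hfe
    have ce := Int.one_le_abs he
    have cf := Int.one_le_abs hf
    rw [Fin.sum_univ_succAbove _ e, ← Finset.add_sum_erase _ _ (Finset.mem_univ f0)] at hv
    have hrest : ∀ i ∈ Finset.univ.erase f0, 0 ≤ |A (e.succAbove i) v| := fun i _ => abs_nonneg _
    have hrest' := Finset.sum_nonneg hrest
    have hz : ∀ i, i ≠ f0 → A (e.succAbove i) v = 0 := by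
      have h0 : ∑ i ∈ Finset.univ.erase f0, |A (e.succAbove i) v| = 0 := by linarith
      intro i hi
      rw [Finset.sum_eq_zero_iff_of_nonneg hrest] at h0
      exact abs_eq_zero.1 (h0 i (by simp [hi]))
    have de : |A e v| = 1 := by linarith
    have df : |A (e.succAbove f0) v| = 1 := by linarith
    obtain ⟨s, hs, hse⟩ : ∃ s : ℤ, |s| = 1 ∧ s * A e v + A (e.succAbove f0) v = 0 := by
      rcases (abs_eq zero_le_one).1 de with h | h <;> rcases (abs_eq zero_le_one).1 df with h' | h'
      · exact ⟨-1, by simp, by rw [h, h']; norm_num⟩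
      · exact ⟨1, by simp, by rw [h, h']; norm_num⟩
      · exact ⟨1, by simp, by rw [h, h']; norm_num⟩
      · exact ⟨-1, by simp, by rw [h, h']; norm_num⟩
    obtain ⟨w, w0, wk, ws, wb⟩ := ih
      (fun i j => A (e.succAbove i) (v.succAbove j) + if i = f0 then s * A e (v.succAbove j) else 0)
      (fun i => by
        by_cases hi : i = f0
        · subst hi
          simp only [if_true]
          calc _ ≤ ∑ j, (|A (e.succAbove i) (v.succAbove j)| + |A e (v.succAbove j)|) := by
                apply Finset.sum_le_sum
                intro j _
                refine (abs_add_le _ _).trans ?_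
                rw [abs_mul, hs, one_mul]
            _ ≤ 2 := by
                rw [Finset.sum_add_distrib]
                linarith [r1 e, r1 (e.succAbove i)]
        · have := r1 (e.succAbove i)
          rw [hz i hi] at this
          simpa [hi] using this)
      (fun i => by
        by_cases hi : i = f0
        · subst hi
          simp only [if_true]
          rw [Finset.sum_add_distrib, ← Finset.mul_sum]
          have := (r2 (e.succAbove i)).add ((r2 e).mul_left s)
          have e : ∑ j, A (e.succAbove i) (v.succAbove j) + s * ∑ j, A e (v.succAbove j) =
              A (e.succAbove i) v + ∑ j, A (e.succAbove i) (v.succAbove j) +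
                s * (A e v + ∑ j, A e (v.succAbove j)) := by
            linear_combination -hse
          rw [e]
          exact this
        · have := r2 (e.succAbove i)
          rw [hz i hi] at this
          simpa [hi] using this)
    refine ⟨e.insertNth (s * w f0) w, ?_, ?_, ?_, ?_⟩
    · intro h
      apply w0
      funext i
      have := congrFun h (e.succAbove i)
      simpa using this
    · intro j
      rw [Fin.sum_univ_succAbove _ e]
      simp only [Fin.insertNth_apply_same, Fin.insertNth_apply_succAbove]
      rcases Fin.eq_self_or_eq_succAbove v j with rfl | ⟨j', rfl⟩
      · rw [Finset.sum_eq_single f0 (fun i _ hi => by rw [hz i hi, mul_zero]) (by simp)]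
        linear_combination (w f0) * hse
      · have := wk j'
        simp only [mul_add, Finset.sum_add_distrib, mul_ite, mul_zero, Finset.sum_ite_eq',
          Finset.sum_ite_eq, Finset.mem_univ, if_true] at this
        linarith
    · rw [Fin.sum_univ_succAbove _ e]
      simp only [Fin.insertNth_apply_same, Fin.insertNth_apply_succAbove]
      rw [abs_mul, hs, one_mul]
      push_cast
      linarith [wb f0]
    · intro i
      rcases Fin.eq_self_or_eq_succAbove e i with rfl | ⟨i', rfl⟩
      · simpa [abs_mul, hs] using wb f0
      · simpa using wb i'

theorem smallKer_all (m : ℕ) : SmallKer (m + 1) := by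
  induction m with
  | zero => exact smallKer_one
  | succ m ih =>
    rcases m with _ | m
    · exact smallKer_two
    · exact smallKer_step _ (by omega) ih

/-- Theorem `thmquadker`: for any quadratic exponent matrix
`A ∈ ℤ_{≥0}^{(n+2)×n}` (each row sums to at most 2) with `n ≥ 1`, there exists a
nonzero integer row vector `w` with `Σᵢ wᵢ = 0`, `wA = 0`, and degree
(sum of positive entries) at most `n + 1`. -/
theorem statement16 (n : ℕ) (hn : 1 ≤ n)
    (A : Matrix (Fin (n + 2)) (Fin n) ℤ)
    (hA : ∀ i j, 0 ≤ A i j) (hrow : ∀ i, ∑ j, A i j ≤ 2) :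
    ∃ w : Fin (n + 2) → ℤ, w ≠ 0 ∧ (∑ i, w i) = 0 ∧
      (∀ j, ∑ i, w i * A i j = 0) ∧ (∑ i, max (w i) 0) ≤ (n : ℤ) + 1 := by
  obtain ⟨w, w0, wk, ws, -⟩ := smallKer_all n
    (fun i => Fin.cons (2 - ∑ j, A i j) (A i))
    (fun i => by
      rw [Fin.sum_univ_succ]
      simp only [Fin.cons_zero, Fin.cons_succ]
      rw [abs_of_nonneg (by linarith [hrow i]),
        Finset.sum_congr rfl fun j _ => abs_of_nonneg (hA i j)]
      linarith)
    (fun i => by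
      rw [Fin.sum_univ_succ]
      simp only [Fin.cons_zero, Fin.cons_succ]
      simp)
  have hk : ∀ j, ∑ i, w i * A i j = 0 := fun j => by simpa using wk j.succ
  have hsum : ∑ i, w i = 0 := by
    have h0 := wk 0
    simp only [Fin.cons_zero, mul_sub, Finset.sum_sub_distrib, Finset.mul_sum] at h0
    rw [Finset.sum_comm (f := fun i j => w i * A i j)] at h0
    simp only [hk, Finset.sum_const_zero, sub_zero] at h0
    rw [← Finset.sum_mul] at h0
    omega
  refine ⟨w, w0, hsum, hk, ?_⟩
  have h2 : 2 * ∑ i, max (w i) 0 = ∑ i, w i + ∑ i, |w i| := by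
    rw [Finset.mul_sum, ← Finset.sum_add_distrib]
    refine Finset.sum_congr rfl fun i _ => ?_
    rcases le_total 0 (w i) with h | h
    · rw [max_eq_left h, abs_of_nonneg h]; ring
    · rw [max_eq_right h, abs_of_nonpos h]; ring
  push_cast at ws
  linarith
end

section
/- Let k ≥ 2 and consider a dynamically nontrivial quadratic mass action network with n species, m = n+k reactions, rank Γ = n, exactly n+2 distinct sources (the rows of A take exactly n+2 distinct values), and which is not source deficient (i.e. rank [A | 1] = n+1, where 1 is the all-ones column). Then for each κ ∈ ℝ^{n+k}_+, the set of nondegenerate equilibria in E_κ has at most n+1 elements. -/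
open Matrix

noncomputable section

theorem aux_rolle (F F' : ℝ → ℝ) (I : Set ℝ) (hI : I.OrdConnected)
    (hF : ∀ t ∈ I, HasDerivAt F (F' t) t) (Z : Finset ℝ) (hZ : ∀ t ∈ Z, t ∈ I ∧ F t = 0) :
    ∃ Z' : Finset ℝ, (∀ t ∈ Z', t ∈ I ∧ F' t = 0) ∧ Z.card ≤ Z'.card + 1 := by
  rcases hq : Z.card with _ | q
  · exact ⟨∅, by simp, by simp⟩
  let e := Z.orderEmbOfFin hq
  have he : ∀ i, e i ∈ Z := fun i => Z.orderEmbOfFin_mem hq i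
  have key : ∀ i : Fin q, ∃ c ∈ Set.Ioo (e i.castSucc) (e i.succ), F' c = 0 := by
    intro i
    have hlt : e i.castSucc < e i.succ := e.strictMono Fin.castSucc_lt_succ
    have hsub : ∀ t ∈ Set.Icc (e i.castSucc) (e i.succ), t ∈ I := fun t ht =>
      hI.out (hZ _ (he _)).1 (hZ _ (he _)).1 ht
    exact exists_hasDerivAt_eq_zero hlt
      (fun t ht => (hF t (hsub t ht)).continuousAt.continuousWithinAt)
      (by rw [(hZ _ (he _)).2, (hZ _ (he _)).2])
      (fun t ht => hF t (hsub t (Set.Ioo_subset_Icc_self ht)))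
  choose c hc hc0 using key
  have hmono : StrictMono c := by
    intro i j hij
    have : e i.succ ≤ e j.castSucc := e.monotone (by
      rw [Fin.le_def]; simp; exact hij)
    exact (hc i).2.trans_le (this.trans (hc j).1.le)
  refine ⟨Finset.univ.map ⟨c, hmono.injective⟩, ?_, by simp⟩
  intro t ht
  simp only [Finset.mem_map, Finset.mem_univ, true_and, Function.Embedding.coeFn_mk] at ht
  obtain ⟨i, rfl⟩ := ht
  exact ⟨hI.out (hZ _ (he _)).1 (hZ _ (he _)).1 (Set.Ioo_subset_Icc_self (hc i)), hc0 i⟩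

theorem aux_poly {ι : Type*} [Fintype ι] [DecidableEq ι] {n : ℕ} (hι : Fintype.card ι = n + 2)
    (c u w : ι → ℝ) (hc : ∑ s, c s = 0) :
    ∃ P : Polynomial ℝ, P.natDegree ≤ n ∧ ∀ t : ℝ, (∀ s, 0 < u s + t * w s) →
      P.eval t = (∏ s, (u s + t * w s)) * ∑ s, c s * (w s / (u s + t * w s)) := by
  let L : ι → Polynomial ℝ := fun s => Polynomial.C (w s) * Polynomial.X + Polynomial.C (u s)
  have hL : ∀ s, (L s).natDegree ≤ 1 := fun s => Polynomial.natDegree_linear_le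
  have hL1 : ∀ s, (L s).coeff 1 = w s := fun s => by simp [L, Polynomial.coeff_C]
  have hcard : ∀ s : ι, (Finset.univ.erase s).card = n + 1 := fun s => by
    rw [Finset.card_erase_of_mem (Finset.mem_univ s), Finset.card_univ, hι]; rfl
  let P : Polynomial ℝ := ∑ s, Polynomial.C (c s * w s) * ∏ j ∈ Finset.univ.erase s, L j
  have hd : P.natDegree ≤ n + 1 := by
    refine Polynomial.natDegree_sum_le_of_forall_le _ _ fun s _ => ?_
    refine (Polynomial.natDegree_C_mul_le _ _).trans ?_
    refine (Polynomial.natDegree_prod_le _ _).trans ?_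
    refine (Finset.sum_le_card_nsmul _ _ 1 fun j _ => hL j).trans ?_
    simp [hcard]
  have h0 : P.coeff (n + 1) = 0 := by
    have : ∀ s, (Polynomial.C (c s * w s) * ∏ j ∈ Finset.univ.erase s, L j).coeff (n+1)
        = (∏ j, w j) * c s := by
      intro s
      have h := Polynomial.coeff_prod_of_natDegree_le (Finset.univ.erase s) L 1 (fun j _ => hL j)
      rw [hcard, mul_one] at h
      rw [Polynomial.coeff_C_mul, h, ← Finset.mul_prod_erase _ _ (Finset.mem_univ s)]
      simp only [hL1]
      ring
    simp only [P, Polynomial.finsetSum_coeff, this]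
    rw [← Finset.mul_sum, hc, mul_zero]
  refine ⟨P, Polynomial.natDegree_le_pred hd h0, fun t ht => ?_⟩
  simp only [P, Polynomial.eval_finsetSum, Finset.mul_sum]
  refine Finset.sum_congr rfl fun s _ => ?_
  rw [← Finset.mul_prod_erase _ _ (Finset.mem_univ s)]
  simp only [Polynomial.eval_mul, Polynomial.eval_C, Polynomial.eval_prod, L, Polynomial.eval_add,
    Polynomial.eval_X]
  have : (∏ j ∈ Finset.univ.erase s, (w j * t + u j)) = ∏ j ∈ Finset.univ.erase s, (u j + t * w j) :=
    Finset.prod_congr rfl fun j _ => by ring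
  rw [this]
  have := (ht s).ne'
  generalize u s + t * w s = q at this
  field_simp

/-- left kernel of `[B|1]` -/
theorem aux_ker {ι : Type*} [Fintype ι] [DecidableEq ι] {n : ℕ} (hι : Fintype.card ι = n + 2)
    (B : ι → Fin n → ℝ)
    (hB : ∀ (y : Fin n → ℝ) (d : ℝ), (∀ s, ∑ j, B s j * y j + d = 0) → y = 0 ∧ d = 0) :
    ∃ c : ι → ℝ, (∀ (y : Fin n → ℝ) (d : ℝ), ∑ s, c s * (∑ j, B s j * y j + d) = 0) ∧
      ∀ v : ι → ℝ, ∑ s, c s * v s = 0 → ∃ (y : Fin n → ℝ) (d : ℝ), ∀ s, v s = ∑ j, B s j * y j + d := by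
  let M : ((Fin n → ℝ) × ℝ) →ₗ[ℝ] (ι → ℝ) :=
    { toFun := fun p s => ∑ j, B s j * p.1 j + p.2
      map_add' := by
        intro p q; ext s; simp [mul_add, Finset.sum_add_distrib]; ring
      map_smul' := by
        intro a p; ext s; simp [mul_add, Finset.mul_sum]
        exact Finset.sum_congr rfl fun j _ => by ring }
  have hM : Function.Injective M := by
    rw [injective_iff_map_eq_zero]
    rintro ⟨y, d⟩ h
    obtain ⟨h1, h2⟩ := hB y d (fun s => congrFun h s)
    simp [h1, h2]
  have hr : Module.finrank ℝ (LinearMap.range M) = n + 1 := by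
    rw [LinearMap.finrank_range_of_inj hM]; simp
  have hlt : LinearMap.range M < ⊤ := by
    rw [lt_top_iff_ne_top]; intro h
    rw [h, finrank_top] at hr
    simp [hι] at hr
  obtain ⟨f, hf, hle⟩ := Submodule.exists_le_ker_of_lt_top _ hlt
  have hfc : ∀ v, f v = ∑ s, f (Pi.single s 1) * v s := by
    intro v
    conv_lhs => rw [← LinearMap.sum_single_apply (fun _ => ℝ) v]
    rw [map_sum]
    refine Finset.sum_congr rfl fun s _ => ?_
    have : (Pi.single s (v s) : ι → ℝ) = v s • Pi.single s 1 := by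
      rw [← Pi.single_smul]; simp
    simp [this, mul_comm]
  have heq : LinearMap.range M = LinearMap.ker f := by
    apply Submodule.eq_of_le_of_finrank_eq hle
    have := Module.Dual.finrank_ker_add_one_of_ne_zero hf
    simp [hι] at this
    omega
  refine ⟨fun s => f (Pi.single s 1), ?_, ?_⟩
  · intro y d
    have : f (M (y, d)) = 0 := hle ⟨_, rfl⟩
    rw [hfc] at this; exact this
  · intro v hv
    have : v ∈ LinearMap.range M := by rw [heq, LinearMap.mem_ker, hfc]; exact hv
    obtain ⟨⟨y, d⟩, h⟩ := this
    exact ⟨y, d, fun s => (congrFun h s).symm⟩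

theorem aux_one {V : Type*} [AddCommGroup V] [Module ℝ V] (S : Submodule ℝ V)
    (h : Module.finrank ℝ S = 1) : ∃ w : S, w ≠ 0 ∧ ∀ v : S, ∃ b : ℝ, b • w = v := by
  obtain ⟨w, hw, h2⟩ := finrank_eq_one_iff'.1 h
  exact ⟨w, hw, h2⟩

theorem aux_basis {ι : Type*} [Fintype ι] [DecidableEq ι] {n : ℕ} (hι : Fintype.card ι = n + 2)
    (N : Matrix (Fin n) ι ℝ) (hN : Function.Surjective (fun v : ι → ℝ => N *ᵥ v))
    (u : ι → ℝ) (hu : N *ᵥ u = 0) (hu1 : 0 < ∑ s, u s) :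
    ∃ w : ι → ℝ, N *ᵥ w = 0 ∧ w ≠ 0 ∧ ∑ s, w s = 0 ∧
      ∀ v : ι → ℝ, N *ᵥ v = 0 → ∃ a b : ℝ, ∀ s, v s = a * u s + b * w s := by
  obtain ⟨K, hKd⟩ : ∃ K : Submodule ℝ (ι → ℝ), K = LinearMap.ker N.mulVecLin := ⟨_, rfl⟩
  have hKm : ∀ v, v ∈ K ↔ N *ᵥ v = 0 := fun v => by rw [hKd]; simp
  have hK : Module.finrank ℝ K = 2 := by
    have h1 := LinearMap.finrank_range_add_finrank_ker N.mulVecLin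
    have h2 : LinearMap.range N.mulVecLin = ⊤ := LinearMap.range_eq_top.2 hN
    rw [h2, finrank_top] at h1
    simp [hι] at h1
    rw [hKd]; omega
  let l0 : (ι → ℝ) →ₗ[ℝ] ℝ := ∑ s, LinearMap.proj s
  have hl0 : ∀ v, l0 v = ∑ s, v s := fun v => by simp [l0]
  let l : K →ₗ[ℝ] ℝ := l0 ∘ₗ K.subtype
  let uK : K := ⟨u, (hKm u).2 hu⟩
  have hlu : l uK = ∑ s, u s := hl0 u
  have hl : l ≠ 0 := fun h => by
    rw [h] at hlu; simp at hlu; linarith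
  have h1 : Module.finrank ℝ (LinearMap.ker l) = 1 := by
    have := Module.Dual.finrank_ker_add_one_of_ne_zero (f := l) hl
    omega
  obtain ⟨w, hw0, hw⟩ := aux_one (LinearMap.ker l) h1
  have hwK : N *ᵥ (w : K).1 = 0 := (hKm _).1 (w : K).2
  refine ⟨(w : K).1, hwK, ?_, ?_, ?_⟩
  · intro h; apply hw0; ext1; ext1; exact h
  · rw [← hl0]; exact w.2
  · intro v hv
    let vK : K := ⟨v, (hKm v).2 hv⟩
    let r := l vK / l uK
    have hmem : vK - r • uK ∈ LinearMap.ker l := by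
      rw [LinearMap.mem_ker, map_sub, map_smul, smul_eq_mul]
      have : l uK ≠ 0 := by rw [hlu]; exact hu1.ne'
      simp only [r]; field_simp; ring
    obtain ⟨b, hb⟩ := hw ⟨_, hmem⟩
    refine ⟨r, b, fun s => ?_⟩
    have := congrFun (congrArg (fun z : LinearMap.ker l => z.1.1) hb) s
    simp [vK, uK] at this
    linarith

theorem aux_core {ι : Type*} [Fintype ι] [DecidableEq ι] {n : ℕ} (hι : Fintype.card ι = n + 2)
    (N : Matrix (Fin n) ι ℝ) (B : ι → Fin n → ℝ)
    (hB : ∀ (y : Fin n → ℝ) (d : ℝ), (∀ s, ∑ j, B s j * y j + d = 0) → y = 0 ∧ d = 0)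
    (T : Finset (Fin n → ℝ)) (hpos : ∀ x ∈ T, ∀ i, 0 < x i)
    (heq : ∀ x ∈ T, N *ᵥ (fun s => ∏ j, x j ^ B s j) = 0)
    (hnd : ∀ x ∈ T, ∀ z : Fin n → ℝ,
      N *ᵥ (fun s => (∏ j, x j ^ B s j) * ∑ j, B s j * z j) = 0 → z = 0) :
    T.card ≤ n + 1 := by
  rcases T.eq_empty_or_nonempty with rfl | ⟨x0, hx0⟩
  · simp
  have hne : Nonempty ι := Fintype.card_pos_iff.1 (by omega)
  have hmpos : ∀ x ∈ T, ∀ s, 0 < ∏ j, x j ^ B s j := fun x hx s =>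
    Finset.prod_pos fun j _ => Real.rpow_pos_of_pos (hpos x hx j) _
  have hlog : ∀ x ∈ T, ∀ s, Real.log (∏ j, x j ^ B s j) = ∑ j, B s j * Real.log (x j) := by
    intro x hx s
    rw [Real.log_prod (fun j _ => (Real.rpow_pos_of_pos (hpos x hx j) _).ne')]
    exact Finset.sum_congr rfl fun j _ => Real.log_rpow (hpos x hx j) _
  have hN : Function.Surjective (fun v : ι → ℝ => N *ᵥ v) := by
    let J : (Fin n → ℝ) →ₗ[ℝ] (Fin n → ℝ) :=
      (N * Matrix.of (fun s j => (∏ i, x0 i ^ B s i) * B s j)).mulVecLin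
    have hJ : ∀ z, J z = N *ᵥ (fun s => (∏ j, x0 j ^ B s j) * ∑ j, B s j * z j) := by
      intro z
      simp only [J, Matrix.mulVecLin_apply, ← Matrix.mulVec_mulVec]
      congr 1
      ext s
      simp [Matrix.mulVec, dotProduct, Finset.mul_sum, mul_assoc]
    have hinj : Function.Injective J := by
      rw [injective_iff_map_eq_zero]
      intro z hz
      exact hnd x0 hx0 z (by rw [← hJ, hz])
    intro y
    obtain ⟨z, hz⟩ := (LinearMap.injective_iff_surjective.1 hinj) y
    exact ⟨_, (hJ z).symm.trans hz⟩
  have hsum : ∀ x ∈ T, 0 < ∑ s, ∏ j, x j ^ B s j := fun x hx =>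
    Finset.sum_pos (fun s _ => hmpos x hx s) Finset.univ_nonempty
  obtain ⟨w, hw, hw0, hw1, hspan⟩ := aux_basis hι N hN _ (heq x0 hx0) (hsum x0 hx0)
  have hu1 := hsum x0 hx0
  set u : ι → ℝ := fun s => ∏ j, x0 j ^ B s j with hu
  have hpar : ∀ x ∈ T, ∃ a t : ℝ, 0 < a ∧ ∀ s, (∏ j, x j ^ B s j) = a * (u s + t * w s) := by
    intro x hx
    obtain ⟨a, b, hab⟩ := hspan _ (heq x hx)
    have ha : 0 < a := by
      have h1 := hsum x hx
      simp only [hab] at h1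
      rw [Finset.sum_add_distrib, ← Finset.mul_sum, ← Finset.mul_sum, hw1, mul_zero, add_zero] at h1
      exact (pos_iff_pos_of_mul_pos h1).2 hu1
    refine ⟨a, b / a, ha, fun s => ?_⟩
    rw [hab]; change a * u s + b * w s = _; field_simp
  choose! a t ha hat using hpar
  have hp : ∀ x ∈ T, ∀ s, 0 < u s + t x * w s := by
    intro x hx s
    have := hmpos x hx s
    rw [hat x hx s] at this
    exact (pos_iff_pos_of_mul_pos this).1 (ha x hx)
  have hlp : ∀ x ∈ T, ∀ s, Real.log (u s + t x * w s)
      = ∑ j, B s j * Real.log (x j) + (-Real.log (a x)) := by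
    intro x hx s
    rw [← hlog x hx, hat x hx, Real.log_mul (ha x hx).ne' (hp x hx s).ne']
    ring
  have hinj : Set.InjOn t T := by
    intro x hx x' hx' h
    have h2 := hB (fun j => Real.log (x j) - Real.log (x' j)) (-Real.log (a x) + Real.log (a x'))
      (fun s => by
        have e1 := hlp x hx s
        have e2 := hlp x' hx' s
        rw [← h] at e2
        simp only [mul_sub, Finset.sum_sub_distrib]
        linarith)
    ext j
    have := congrFun h2.1 j
    simp only [Pi.zero_apply] at this
    exact Real.log_injOn_pos (hpos x hx j) (hpos x' hx' j) (by linarith)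
  obtain ⟨c, hc1, hc2⟩ := aux_ker hι B hB
  have hcs : ∑ s, c s = 0 := by simpa using hc1 0 1
  obtain ⟨P, hPd, hP⟩ := aux_poly hι c u w hcs
  let I : Set ℝ := {t | ∀ s, 0 < u s + t * w s}
  have hI : I.OrdConnected := by
    refine ⟨fun y hy z hz r hr s => ?_⟩
    have h1 := hy s
    have h2 := hz s
    rcases le_total 0 (w s) with h | h
    · nlinarith [hr.1, hr.2]
    · nlinarith [hr.1, hr.2]
  let F : ℝ → ℝ := fun r => ∑ s, c s * Real.log (u s + r * w s)
  let F' : ℝ → ℝ := fun r => ∑ s, c s * (w s / (u s + r * w s))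
  have hF : ∀ r ∈ I, HasDerivAt F (F' r) r := by
    intro r hr
    refine HasDerivAt.fun_sum fun s _ => ?_
    have h1 : HasDerivAt (fun r => u s + r * w s) (w s) r := by
      simpa using ((hasDerivAt_id r).mul_const (w s)).const_add (u s)
    exact (h1.log (hr s).ne').const_mul (c s)
  have hF0 : ∀ x ∈ T, F (t x) = 0 := by
    intro x hx
    simp only [F, hlp x hx]
    exact hc1 _ _
  have hFnd : F' (t x0) ≠ 0 := by
    intro h
    obtain ⟨y, d, hyd⟩ := hc2 _ h
    have hpne : ∀ s, u s + t x0 * w s ≠ 0 := fun s => (hp x0 hx0 s).ne'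
    have hu2 : N *ᵥ u = 0 := heq x0 hx0
    have hwd : ∀ s, (u s + t x0 * w s) * ∑ j, B s j * y j = w s - d * (u s + t x0 * w s) := by
      intro s
      have h3 := hyd s
      rw [div_eq_iff (hpne s)] at h3
      linarith
    have hy : y = 0 := by
      apply hnd x0 hx0
      have : (fun s => (∏ j, x0 j ^ B s j) * ∑ j, B s j * y j)
          = a x0 • (w - d • (u + t x0 • w)) := by
        ext s
        rw [hat x0 hx0, mul_assoc, hwd s]
        rfl
      rw [this]
      simp [Matrix.mulVec_smul, Matrix.mulVec_sub, Matrix.mulVec_add, hw, hu2]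
    have hwd2 : ∀ s, w s = d * (u s + t x0 * w s) := by
      intro s
      have := hwd s
      rw [hy] at this
      simp at this
      linarith
    have hd : d = 0 := by
      have h4 : ∑ s, w s = ∑ s, d * (u s + t x0 * w s) := Finset.sum_congr rfl fun s _ => hwd2 s
      rw [hw1, ← Finset.mul_sum, Finset.sum_add_distrib, ← Finset.mul_sum, hw1, mul_zero,
        add_zero] at h4
      rcases mul_eq_zero.1 h4.symm with h | h
      · exact h
      · exact absurd h hu1.ne'
    apply hw0
    ext s
    rw [hwd2 s, hd]; simp
  have hP0 : P ≠ 0 := by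
    intro h
    have h5 := hP (t x0) (hp x0 hx0)
    rw [h, Polynomial.eval_zero] at h5
    rcases mul_eq_zero.1 h5.symm with h | h
    · exact absurd h (Finset.prod_pos fun s _ => hp x0 hx0 s).ne'
    · exact hFnd h
  obtain ⟨Z', hZ', hcard⟩ := aux_rolle F F' I hI hF (T.image t) (by
    intro r hr
    obtain ⟨x, hx, rfl⟩ := Finset.mem_image.1 hr
    exact ⟨hp x hx, hF0 x hx⟩)
  rw [Finset.card_image_of_injOn hinj] at hcard
  have : Z'.card ≤ P.natDegree := by
    apply Polynomial.card_le_degree_of_subset_roots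
    intro r hr
    have hr' := Multiset.mem_toFinset.1 (by simpa using hr : r ∈ Z'.val.toFinset)
    rw [Polynomial.mem_roots hP0, Polynomial.IsRoot.def, hP r (hZ' r hr').1]
    have : F' r = 0 := (hZ' r hr').2
    simp only [F'] at this
    rw [this, mul_zero]
  omega

/-- Theorem `thmquadnn2n`: a dynamically nontrivial quadratic
`(n, n+k, n)` network (`k ≥ 2`) with exactly `n+2` distinct sources which is not
source deficient (`rank [A|1] = n+1`) admits at most `n+1` positive nondegenerate
equilibria for each choice of rate constants. -/
theorem statement17 {n k : ℕ} (hk : 2 ≤ k)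
    (Γ : Matrix (Fin n) (Fin (n + k)) ℤ) (A : Matrix (Fin (n + k)) (Fin n) ℤ)
    (hA : ∀ i j, 0 ≤ A i j) (hquad : ∀ i, ∑ j, A i j ≤ 2)
    (hdyn : dynNontrivial Γ) (hrank : (mR Γ).rank = n)
    (hsrc : Set.ncard
      (Set.range fun i : Fin (n + k) => (fun j => A i j : Fin n → ℤ)) = n + 2)
    (hsd : (Matrix.of fun i : Fin (n + k) => Fin.snoc (fun j => (A i j : ℝ)) 1 :
        Matrix (Fin (n + k)) (Fin (n + 1)) ℝ).rank = n + 1)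
    (κ : Fin (n + k) → ℝ) (hκ : κ ∈ posOrth (n + k)) :
    ∀ T : Finset (Fin n → ℝ),
      ↑T ⊆ {x | x ∈ Eset Γ A κ ∧ nondegAt Γ A κ x} → T.card ≤ n + 1 := by
  intro T hT
  classical
  let row : Fin (n + k) → Fin n → ℤ := fun i => (fun j => A i j : Fin n → ℤ)
  let ι := Set.range row
  let σ : Fin (n + k) → ι := fun i => ⟨row i, i, rfl⟩
  have hσ : Function.Surjective σ := by
    rintro ⟨_, i, rfl⟩; exact ⟨i, rfl⟩
  have hι : Fintype.card ι = n + 2 := by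
    rw [← Nat.card_eq_fintype_card, Nat.card_coe_set_eq]; exact hsrc
  let B : ι → Fin n → ℝ := fun s j => (s.1 j : ℝ)
  let N : Matrix (Fin n) ι ℝ := Matrix.of fun a s =>
    ∑ i, if σ i = s then (Γ a i : ℝ) * κ i else 0
  have hN : ∀ g : ι → ℝ, N *ᵥ g = (mR Γ) *ᵥ (κ * fun i => g (σ i)) := by
    intro g
    ext a
    simp only [N, Matrix.mulVec, dotProduct, Matrix.of_apply, mR, Matrix.map_apply, Pi.mul_apply,
      Finset.sum_mul]
    rw [Finset.sum_comm]
    refine Finset.sum_congr rfl fun i _ => ?_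
    simp [ite_mul, mul_assoc]
  have hpow : ∀ x : Fin n → ℝ, powVec (mR A) x = fun i => ∏ j, x j ^ B (σ i) j := fun x => rfl
  have hB : ∀ (y : Fin n → ℝ) (d : ℝ), (∀ s, ∑ j, B s j * y j + d = 0) → y = 0 ∧ d = 0 := by
    intro y d h
    set M : Matrix (Fin (n + k)) (Fin (n + 1)) ℝ :=
      Matrix.of fun i : Fin (n + k) => Fin.snoc (fun j => (A i j : ℝ)) 1 with hM
    have hker : LinearMap.ker M.mulVecLin = ⊥ := by
      have h1 := LinearMap.finrank_range_add_finrank_ker M.mulVecLin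
      rw [← Submodule.finrank_eq_zero (R := ℝ)]
      have h2 : Module.finrank ℝ (LinearMap.range M.mulVecLin) = n + 1 := hsd
      rw [h2] at h1
      simp at h1
      simp [h1]
    have h3 : (Fin.snoc y d : Fin (n + 1) → ℝ) ∈ LinearMap.ker M.mulVecLin := by
      rw [LinearMap.mem_ker, Matrix.mulVecLin_apply]
      ext i
      simp only [hM, Matrix.mulVec, dotProduct, Fin.sum_univ_castSucc, Matrix.of_apply,
        Fin.snoc_castSucc, Fin.snoc_last, one_mul, Pi.zero_apply]
      exact h (σ i)
    rw [hker, Submodule.mem_bot] at h3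
    refine ⟨?_, ?_⟩
    · ext j
      have := congrFun h3 j.castSucc
      simpa using this
    · have := congrFun h3 (Fin.last n)
      simpa using this
  have hsurj : ∀ z : Fin n → ℝ, ∃ v, (mR Γ).mulVec v = z := by
    have : LinearMap.range (mR Γ).mulVecLin = ⊤ := by
      apply Submodule.eq_top_of_finrank_eq
      have h2 : Module.finrank ℝ (LinearMap.range (mR Γ).mulVecLin) = n := hrank
      rw [h2]; simp
    exact LinearMap.range_eq_top.1 this
  refine aux_core hι N B hB T (fun x hx => (hT hx).1.1) ?_ ?_
  · intro x hx
    rw [hN]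
    exact (hT hx).1.2
  · intro x hx z hz
    have hx0 : ∀ i, x i ≠ 0 := fun i => ((hT hx).1.1 i).ne'
    have h1 : (fun j => x j * z j) = 0 := by
      refine (hT hx).2 _ ?_ (hsurj _)
      rw [hN] at hz
      rw [← hz, jacMat, ← Matrix.mulVec_mulVec, ← Matrix.mulVec_mulVec, ← Matrix.mulVec_mulVec]
      congr 1
      have h2 : Matrix.diagonal (fun i => (x i)⁻¹) *ᵥ (fun j => x j * z j) = z := by
        ext j
        rw [Matrix.mulVec_diagonal]
        field_simp [hx0 j]
      rw [h2]
      ext i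
      rw [Matrix.mulVec_diagonal, hpow]
      simp only [Pi.mul_apply, mul_assoc]
      rfl
    ext j
    have := congrFun h1 j
    simpa [hx0 j] using this

end
end

section
/- Let A ∈ ℤ_{≥0}^{m×n} have all row sums at most 2 (a quadratic exponent matrix), and suppose the all-ones vector 1 ∈ ℝ^m lies in the image of A, i.e. there exists z ∈ ℝ^n with Az = 1. Then there exists a vector z ∈ {0,1,2}^n with Az = 2·1, the vector of twos. -/
theorem peel19 {n : ℕ} (f : Fin n → ℤ) (N : ℤ) (hf : ∀ j, 0 ≤ f j) (hs : ∑ j, f j ≤ N + 1)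
    (h0 : f ≠ 0) : ∃ (j : Fin n) (g : Fin n → ℤ), f = Pi.single j 1 + g ∧ (∀ k, 0 ≤ g k) ∧
      ∑ k, g k ≤ N := by
  obtain ⟨j, hj⟩ := Function.ne_iff.mp h0
  refine ⟨j, f - Pi.single j 1, by simp, ?_, ?_⟩
  · intro k
    have := hf k
    by_cases hk : k = j
    · subst hk
      simp at hj ⊢
      omega
    · simp [hk, this]
  · simp [Finset.sum_sub_distrib]
    omega

theorem zero19 {n : ℕ} (f : Fin n → ℤ) (hf : ∀ j, 0 ≤ f j) (hs : ∑ j, f j ≤ 0) : f = 0 := by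
  have h : ∑ j, f j = 0 := le_antisymm hs (Finset.sum_nonneg fun j _ => hf j)
  funext j
  exact (Finset.sum_eq_zero_iff_of_nonneg (fun j _ => hf j)).mp h j (Finset.mem_univ j)

theorem shape19 {n : ℕ} (f : Fin n → ℤ) (hf : ∀ j, 0 ≤ f j) (hs : ∑ j, f j ≤ 2) :
    f = 0 ∨ (∃ j, f = Pi.single j 1) ∨ ∃ j k, f = Pi.single j 1 + Pi.single k 1 := by
  by_cases h0 : f = 0
  · exact Or.inl h0
  obtain ⟨j, g, rfl, hg, hgs⟩ := peel19 f 1 hf (by simpa using hs) h0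
  by_cases h1 : g = 0
  · subst h1
    exact Or.inr (Or.inl ⟨j, by simp⟩)
  obtain ⟨k, r, rfl, hr, hrs⟩ := peel19 g 0 hg (by simpa using hgs) h1
  have := zero19 r hr hrs
  subst this
  exact Or.inr (Or.inr ⟨j, k, by simp⟩)

/-- Lemma `lemquadker2`: if `A` is a quadratic exponent matrix
(nonnegative integer entries, row sums at most 2) and the all-ones vector lies in
the image of `A` (over ℝ), then there is a `(0,1,2)`-vector `z` with `Az = 2·1`. -/
theorem statement19 {m n : ℕ} (A : Matrix (Fin m) (Fin n) ℤ)
    (hA : ∀ i j, 0 ≤ A i j) (hrow : ∀ i, ∑ j, A i j ≤ 2)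
    (h1 : ∃ z : Fin n → ℝ, (A.map fun t => (t : ℝ)).mulVec z = fun _ => 1) :
    ∃ z : Fin n → ℤ, (∀ j, z j = 0 ∨ z j = 1 ∨ z j = 2) ∧
      A.mulVec z = fun _ => 2 := by
  obtain ⟨z, hz⟩ := h1
  refine ⟨fun j => if z j < 1/2 then 0 else if z j = 1/2 then 1 else 2, ?_, ?_⟩
  · intro j
    dsimp only
    split_ifs <;> simp
  · funext i
    have hi := congrFun hz i
    simp only [Matrix.mulVec, dotProduct, Matrix.map_apply] at hi ⊢
    rcases shape19 (A i) (hA i) (hrow i) with h | ⟨j, h⟩ | ⟨j, k, h⟩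
    · simp [h] at hi
    · simp only [h, Pi.single_apply] at hi ⊢
      simp at hi
      simp only [ite_mul, one_mul, zero_mul, Finset.sum_ite_eq', Finset.mem_univ, if_true, hi]
      norm_num
    · simp only [h, Pi.add_apply, Pi.single_apply, add_mul, Finset.sum_add_distrib, Int.cast_add] at hi ⊢
      simp at hi
      simp only [ite_mul, one_mul, zero_mul, Finset.sum_ite_eq', Finset.mem_univ, if_true]
      split_ifs <;> first | rfl | (exfalso; grind)
end
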